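/- Assume ξ_{1,r} = ξ_{2,r} =: ξ_r. Then for every k ≥ 1, Σ_{σ∈Λ_{k,r}} h(σ)^{ξ_r/(ξ_r+r)} ≥ (p_0 · l_{1k})^{ξ_r/(ξ_r+r)}. -/

import Mathlib

open MeasureTheory Filter

/-- The `n`-th quantization error of order `r` of a Borel measure `P` on `ℝ^q`:
the infimum of `(∫ d(x,α)^r dP)^{1/r}` over finite sets `α` with `1 ≤ card α ≤ n`. -/
noncomputable def quantErr {q : ℕ} (P : Measure (EuclideanSpace ℝ (Fin q)))
    (n : ℕ) (r : ℝ) : ℝ :=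
  sInf ((fun α : Finset (EuclideanSpace ℝ (Fin q)) =>
      (∫ x, Metric.infDist x (α : Set (EuclideanSpace ℝ (Fin q))) ^ r ∂P) ^ (1 / r)) ''
    {α : Finset (EuclideanSpace ℝ (Fin q)) | α.Nonempty ∧ α.card ≤ n})

/-- Product of weights `g` along a word `σ` (equals `1` for the empty word). -/
noncomputable def prodw {N : ℕ} (g : Fin N → ℝ) (σ : List (Fin N)) : ℝ := (σ.map g).prod

/-- The composition `f_{σ_1} ∘ ⋯ ∘ f_{σ_n}` along a word `σ`. -/
def wordMap {q N : ℕ} (f : Fin N → EuclideanSpace ℝ (Fin q) → EuclideanSpace ℝ (Fin q))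
    (σ : List (Fin N)) : EuclideanSpace ℝ (Fin q) → EuclideanSpace ℝ (Fin q) :=
  σ.foldr (fun i g => f i ∘ g) id

/-- `h(σ) = h^{(1)}(σ) + h^{(2)}(σ)` where
`h^{(1)}(σ) = Σ_{j=0}^{|σ|-1} p0 p_{σ|_j} t_{σ^{(l)}_{-j}} s_σ^r` and `h^{(2)}(σ) = p_σ s_σ^r`. -/
noncomputable def hfun {N : ℕ} (r p0 : ℝ) (s t p : Fin N → ℝ) (σ : List (Fin N)) : ℝ :=
  (∑ j ∈ Finset.range σ.length, p0 * prodw p (σ.take j) * prodw t (σ.drop j)) * prodw s σ ^ r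
    + prodw p σ * prodw s σ ^ r

/-- `η̲_r := min_{1 ≤ i ≤ N} min{p0 t_i + p_i, t_i} · s_i^r`. -/
noncomputable def etaLow {N : ℕ} (r p0 : ℝ) (s t p : Fin N → ℝ) : ℝ :=
  ⨅ i, min (p0 * t i + p i) (t i) * s i ^ r

/-- The finite maximal antichain `Λ_{k,r} = {σ : h(σ|_{|σ|-1}) ≥ η̲_r/k > h(σ)}`. -/
def Lam {N : ℕ} (r p0 : ℝ) (s t p : Fin N → ℝ) (k : ℕ) : Set (List (Fin N)) :=
  {σ | σ ≠ [] ∧ etaLow r p0 s t p / k ≤ hfun r p0 s t p σ.dropLast ∧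
    hfun r p0 s t p σ < etaLow r p0 s t p / k}

/-- `a(x) = Σ_i (t_i s_i^r)^{x/(x+r)}` (also used for `b` with `p` in place of `t`). -/
noncomputable def afun {N : ℕ} (r : ℝ) (s t : Fin N → ℝ) (x : ℝ) : ℝ :=
  ∑ i, (t i * s i ^ r) ^ (x / (x + r))

lemma prodw_nil {N : ℕ} (g : Fin N → ℝ) : prodw g [] = 1 := by
  simp [prodw]

lemma prodw_concat {N : ℕ} (g : Fin N → ℝ) (σ : List (Fin N)) (i : Fin N) :
    prodw g (σ ++ [i]) = prodw g σ * g i := by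
  simp [prodw]

lemma prodw_pos {N : ℕ} {g : Fin N → ℝ} (hg : ∀ i, 0 < g i) (σ : List (Fin N)) :
    0 < prodw g σ := by
  induction σ using List.reverseRecOn with
  | nil => simp [prodw_nil]
  | append_singleton σ i ih => rw [prodw_concat]; exact mul_pos ih (hg i)

/-- The `j`-th summand of `h^{(1)}(σ)` without the factor `p0`, extended to all `j`. -/
noncomputable def mixedWeight {N : ℕ} (r : ℝ) (s t p : Fin N → ℝ) (j : ℕ)
    (σ : List (Fin N)) : ℝ :=
  prodw p (σ.take j) * prodw t (σ.drop j) * prodw s σ ^ r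

lemma mixedWeight_nil {N : ℕ} (r : ℝ) (s t p : Fin N → ℝ) (j : ℕ) :
    mixedWeight r s t p j [] = 1 := by
  simp [mixedWeight, prodw_nil]

lemma mixedWeight_pos {N : ℕ} (r : ℝ) {s t p : Fin N → ℝ} (hs : ∀ i, 0 < s i)
    (ht : ∀ i, 0 < t i) (hp : ∀ i, 0 < p i) (j : ℕ) (σ : List (Fin N)) :
    0 < mixedWeight r s t p j σ :=
  mul_pos (mul_pos (prodw_pos hp _) (prodw_pos ht _)) (Real.rpow_pos_of_pos (prodw_pos hs _) _)

lemma mixedWeight_concat {N : ℕ} (r : ℝ) {s : Fin N → ℝ} (hs : ∀ i, 0 < s i)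
    (t p : Fin N → ℝ) (j : ℕ) (σ : List (Fin N)) (i : Fin N) :
    mixedWeight r s t p j (σ ++ [i]) =
      mixedWeight r s t p j σ * ((if σ.length < j then p i else t i) * s i ^ r) := by
  unfold mixedWeight
  rw [prodw_concat s, Real.mul_rpow (prodw_pos hs σ).le (hs i).le]
  split_ifs with h
  · rw [List.take_of_length_le (by simp; omega), List.drop_of_length_le (by simp; omega),
      List.take_of_length_le h.le, List.drop_of_length_le h.le, prodw_concat]
    ring
  · push Not at h
    rw [List.take_append_of_le_length h, List.drop_append_of_le_length h, prodw_concat]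
    ring

/-- If both `t` and `p` have `e`-power sum one, the `e`-th powers of the mixed weights are
consistent along the word tree. -/
lemma sum_mixedWeight_concat_rpow {N : ℕ} (r e : ℝ) {s t p : Fin N → ℝ} (hs : ∀ i, 0 < s i)
    (ht : ∀ i, 0 < t i) (hp : ∀ i, 0 < p i) (hte : ∑ i, (t i * s i ^ r) ^ e = 1)
    (hpe : ∑ i, (p i * s i ^ r) ^ e = 1) (j : ℕ) (σ : List (Fin N)) :
    ∑ i, mixedWeight r s t p j (σ ++ [i]) ^ e = mixedWeight r s t p j σ ^ e := by
  have key : ∀ i, mixedWeight r s t p j (σ ++ [i]) ^ e = mixedWeight r s t p j σ ^ e *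
      ((if σ.length < j then p i else t i) * s i ^ r) ^ e := fun i ↦ by
    rw [mixedWeight_concat r hs, Real.mul_rpow (mixedWeight_pos r hs ht hp j σ).le]
    have := Real.rpow_pos_of_pos (hs i) r
    have := ht i
    have := hp i
    split_ifs <;> positivity
  simp_rw [key, ← Finset.mul_sum]
  split_ifs <;> simp [hte, hpe]

lemma hfun_eq {N : ℕ} (r p0 : ℝ) (s t p : Fin N → ℝ) (σ : List (Fin N)) :
    hfun r p0 s t p σ =
      p0 * ∑ j ∈ Finset.range σ.length, mixedWeight r s t p j σ + prodw p σ * prodw s σ ^ r := by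
  simp only [hfun, mixedWeight, Finset.mul_sum, Finset.sum_mul]
  congr 1
  exact Finset.sum_congr rfl fun _ _ ↦ by ring

lemma hfun_concat_le {N : ℕ} (r : ℝ) {p0 : ℝ} {s t p : Fin N → ℝ} (hs : ∀ i, 0 < s i)
    (ht : ∀ i, 0 < t i) (hp0 : 0 < p0) (hp : ∀ i, 0 < p i) {i : Fin N} (hti : t i ≤ 1)
    (hpi : p0 + p i ≤ 1) (σ : List (Fin N)) :
    hfun r p0 s t p (σ ++ [i]) ≤ s i ^ r * hfun r p0 s t p σ := by
  have hsum : ∑ j ∈ Finset.range σ.length, mixedWeight r s t p j (σ ++ [i]) =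
      (∑ j ∈ Finset.range σ.length, mixedWeight r s t p j σ) * (t i * s i ^ r) := by
    rw [Finset.sum_mul]
    refine Finset.sum_congr rfl fun j hj ↦ ?_
    rw [mixedWeight_concat r hs, if_neg (Finset.mem_range.1 hj).not_gt]
  have hlast : mixedWeight r s t p σ.length σ = prodw p σ * prodw s σ ^ r := by
    simp [mixedWeight, prodw_nil]
  have hS : 0 ≤ ∑ j ∈ Finset.range σ.length, mixedWeight r s t p j σ :=
    Finset.sum_nonneg fun j _ ↦ (mixedWeight_pos r hs ht hp j σ).le
  rw [hfun_eq, hfun_eq, List.length_append, List.length_singleton, Finset.sum_range_succ, hsum,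
    mixedWeight_concat r hs, if_neg (lt_irrefl _), hlast, prodw_concat, prodw_concat,
    Real.mul_rpow (prodw_pos hs σ).le (hs i).le]
  have hq : 0 < prodw p σ * prodw s σ ^ r :=
    mul_pos (prodw_pos hp σ) (Real.rpow_pos_of_pos (prodw_pos hs σ) r)
  have hsr := Real.rpow_pos_of_pos (hs i) r
  have h1 : t i * (p0 * ∑ j ∈ Finset.range σ.length, mixedWeight r s t p j σ) ≤
      1 * (p0 * ∑ j ∈ Finset.range σ.length, mixedWeight r s t p j σ) := by gcongr
  have h2 : (p0 * t i + p i) * (prodw p σ * prodw s σ ^ r) ≤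
      1 * (prodw p σ * prodw s σ ^ r) := by
    gcongr
    nlinarith
  have h3 := mul_le_mul_of_nonneg_left (add_le_add h1 h2) hsr.le
  linarith

lemma hfun_le_pow_length {N : ℕ} (r : ℝ) {p0 : ℝ} {s t p : Fin N → ℝ} (hs : ∀ i, 0 < s i)
    (ht : ∀ i, 0 < t i) (hp0 : 0 < p0) (hp : ∀ i, 0 < p i) (ht1 : ∀ i, t i ≤ 1)
    (hp1 : ∀ i, p0 + p i ≤ 1) {c : ℝ} (hc : ∀ i, s i ^ r ≤ c) (σ : List (Fin N)) :
    hfun r p0 s t p σ ≤ c ^ σ.length := by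
  induction σ using List.reverseRecOn with
  | nil => simp [hfun, prodw_nil]
  | append_singleton σ i ih =>
    have hsr := Real.rpow_pos_of_pos (hs i) r
    calc hfun r p0 s t p (σ ++ [i]) ≤ s i ^ r * hfun r p0 s t p σ :=
          hfun_concat_le r hs ht hp0 hp (ht1 i) (hp1 i) σ
      _ ≤ s i ^ r * c ^ σ.length := by gcongr
      _ ≤ c * c ^ σ.length := by
          gcongr
          · exact pow_nonneg (hsr.le.trans (hc i)) _
          · exact hc i
      _ = c ^ (σ ++ [i]).length := by simp [pow_succ']

/-- Stopping the word tree at depth `n`: the stopped words together with the surviving words of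
length `n` carry the total mass of every consistent weight. -/
lemma exists_stopped_words {N : ℕ} (r p0 : ℝ) (s t p : Fin N → ℝ) (k : ℕ)
    (h0 : etaLow r p0 s t p / k ≤ hfun r p0 s t p []) (n : ℕ) :
    ∃ A B : Finset (List (Fin N)),
      (∀ σ ∈ A, σ ∈ Lam r p0 s t p k ∧ σ.length ≤ n) ∧
      (∀ σ ∈ B, σ.length = n ∧ etaLow r p0 s t p / k ≤ hfun r p0 s t p σ) ∧
      ∀ w : List (Fin N) → ℝ, (∀ σ, ∑ i, w (σ ++ [i]) = w σ) →
        ∑ σ ∈ A, w σ + ∑ σ ∈ B, w σ = w [] := by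
  classical
  induction n with
  | zero => exact ⟨∅, {[]}, by simp, by simpa using h0, by simp⟩
  | succ n ih =>
    obtain ⟨A, B, hA, hB, hw⟩ := ih
    let C : Finset (List (Fin N)) := (B ×ˢ Finset.univ).image fun x ↦ x.1 ++ [x.2]
    have hC : ∀ σ ∈ C, ∃ τ ∈ B, ∃ i, τ ++ [i] = σ := by
      intro σ hσ
      obtain ⟨x, hx, rfl⟩ := Finset.mem_image.1 hσ
      exact ⟨x.1, (Finset.mem_product.1 hx).1, x.2, rfl⟩
    have hClen : ∀ σ ∈ C, σ.length = n + 1 := by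
      intro σ hσ
      obtain ⟨τ, hτ, i, rfl⟩ := hC σ hσ
      simp [(hB τ hτ).1]
    refine ⟨A ∪ C.filter (fun σ ↦ hfun r p0 s t p σ < etaLow r p0 s t p / k),
      C.filter (fun σ ↦ ¬ hfun r p0 s t p σ < etaLow r p0 s t p / k), ?_, ?_, ?_⟩
    · intro σ hσ
      rcases Finset.mem_union.1 hσ with hσ | hσ
      · exact ⟨(hA σ hσ).1, (hA σ hσ).2.trans n.le_succ⟩
      · obtain ⟨hσC, hlt⟩ := Finset.mem_filter.1 hσ
        refine ⟨?_, (hClen σ hσC).le⟩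
        obtain ⟨τ, hτ, i, rfl⟩ := hC σ hσC
        exact ⟨by simp, by simpa using (hB τ hτ).2, hlt⟩
    · intro σ hσ
      obtain ⟨hσC, hlt⟩ := Finset.mem_filter.1 hσ
      exact ⟨hClen σ hσC, not_lt.1 hlt⟩
    · intro w hcons
      have hdisj : Disjoint A (C.filter fun σ ↦ hfun r p0 s t p σ < etaLow r p0 s t p / k) := by
        refine Finset.disjoint_left.2 fun σ hσA hσ ↦ ?_
        have h1 := (hA σ hσA).2
        have h2 := hClen σ (Finset.mem_filter.1 hσ).1
        omega
      have hinj : Set.InjOn (fun x : List (Fin N) × Fin N ↦ x.1 ++ [x.2])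
          (B ×ˢ Finset.univ : Finset (List (Fin N) × Fin N)) := by
        rintro ⟨σ, i⟩ - ⟨τ, j⟩ - h
        simpa using List.append_inj' h rfl
      rw [Finset.sum_union hdisj, add_assoc, Finset.sum_filter_add_sum_filter_not,
        Finset.sum_image hinj, Finset.sum_product]
      simp only [hcons]
      exact hw w hcons

/-- The words of `Lam` carry at least the total mass of every nonnegative consistent weight. -/
lemma weight_nil_le_sum_Lam {N : ℕ} {r p0 : ℝ} {s t p : Fin N → ℝ} {k : ℕ}
    (h0 : etaLow r p0 s t p / k ≤ hfun r p0 s t p []) {M : ℕ}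
    (hM : ∀ σ : List (Fin N), M ≤ σ.length → hfun r p0 s t p σ < etaLow r p0 s t p / k)
    (hfin : (Lam r p0 s t p k).Finite) {w : List (Fin N) → ℝ} (hw0 : ∀ σ, 0 ≤ w σ)
    (hw : ∀ σ, ∑ i, w (σ ++ [i]) = w σ) :
    w [] ≤ ∑ σ ∈ hfin.toFinset, w σ := by
  obtain ⟨A, B, hA, hB, hAB⟩ := exists_stopped_words r p0 s t p k h0 M
  have hB0 : B = ∅ := Finset.eq_empty_of_forall_notMem fun σ hσ ↦
    (hB σ hσ).2.not_gt (hM σ (hB σ hσ).1.ge)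
  rw [← hAB w hw, hB0, Finset.sum_empty, add_zero]
  exact Finset.sum_le_sum_of_subset_of_nonneg (fun σ hσ ↦ by simpa using (hA σ hσ).1)
    fun σ _ _ ↦ hw0 σ

lemma finite_Lam {N : ℕ} {r p0 : ℝ} {s t p : Fin N → ℝ} {k M : ℕ}
    (hM : ∀ σ : List (Fin N), M ≤ σ.length → hfun r p0 s t p σ < etaLow r p0 s t p / k) :
    (Lam r p0 s t p k).Finite := by
  refine (List.finite_length_le (Fin N) M).subset fun σ hσ ↦ ?_
  by_contra hlen
  refine hσ.2.1.not_gt (hM _ ?_)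
  simp only [Set.mem_ofPred_eq] at hlen
  simp only [List.length_dropLast]
  omega

/-- Concavity of `x ↦ x ^ e`, in unnormalised form. -/
lemma rpow_mul_sum_rpow_le {e : ℝ} (he0 : 0 < e) (he1 : e ≤ 1) (l : ℕ) {x : ℕ → ℝ}
    (hx : ∀ j, 0 ≤ x j) :
    (l : ℝ) ^ e * ((l : ℝ)⁻¹ * ∑ j ∈ Finset.range l, x j ^ e) ≤
      (∑ j ∈ Finset.range l, x j) ^ e := by
  rcases Nat.eq_zero_or_pos l with rfl | hl
  · simp [he0.ne']
  have hl' : (0 : ℝ) < l := by exact_mod_cast hl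
  have hJ := (Real.concaveOn_rpow he0.le he1).le_map_sum (t := Finset.range l)
    (w := fun _ ↦ (l : ℝ)⁻¹) (p := x) (fun _ _ ↦ by positivity)
    (by simp [hl'.ne']) (fun j _ ↦ hx j)
  simp only [smul_eq_mul, ← Finset.mul_sum] at hJ
  have hsum : 0 ≤ ∑ j ∈ Finset.range l, x j := Finset.sum_nonneg fun j _ ↦ hx j
  calc _ ≤ (l : ℝ) ^ e * ((l : ℝ)⁻¹ * ∑ j ∈ Finset.range l, x j) ^ e := by gcongr
    _ = _ := by
      rw [← Real.mul_rpow hl'.le (by positivity), mul_inv_cancel_left₀ hl'.ne']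

lemma etaLow_pos {N : ℕ} [Nonempty (Fin N)] (r : ℝ) {p0 : ℝ} {s t p : Fin N → ℝ}
    (hs : ∀ i, 0 < s i) (ht : ∀ i, 0 < t i) (hp0 : 0 < p0) (hp : ∀ i, 0 < p i) :
    0 < etaLow r p0 s t p := by
  obtain ⟨i, hi⟩ := exists_eq_ciInf_of_finite (f := fun i ↦ min (p0 * t i + p i) (t i) * s i ^ r)
  rw [etaLow, ← hi]
  have h1 := ht i
  have h2 := hp i
  exact mul_pos (lt_min (by positivity) h1) (Real.rpow_pos_of_pos (hs i) r)

lemma etaLow_le_one {N : ℕ} [Nonempty (Fin N)] {r : ℝ} (hr : 0 < r) (p0 : ℝ)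
    {s t : Fin N → ℝ} (p : Fin N → ℝ) (hs : ∀ i, s i ∈ Set.Ioo (0 : ℝ) 1) (ht : ∀ i, t i ≤ 1) :
    etaLow r p0 s t p ≤ 1 := by
  obtain ⟨i⟩ := ‹Nonempty (Fin N)›
  refine (ciInf_le (Set.finite_range _).bddBelow i).trans ?_
  exact mul_le_one₀ ((min_le_right _ _).trans (ht i)) (Real.rpow_nonneg (hs i).1.le r)
    (Real.rpow_le_one (hs i).1.le (hs i).2.le hr.le)

/-- Lemma (Zhu): if `ξ_{1,r} = ξ_{2,r} =: ξ_r`, then for every `k ≥ 1`,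
`Σ_{σ∈Λ_{k,r}} h(σ)^{ξ_r/(ξ_r+r)} ≥ (p_0 l_{1k})^{ξ_r/(ξ_r+r)}`. -/
theorem sum_h_pow_ge_of_xi_eq
    (N : ℕ) (hN : 2 ≤ N) (r : ℝ) (hr : 0 < r)
    (s : Fin N → ℝ) (hs : ∀ i, s i ∈ Set.Ioo (0 : ℝ) 1)
    (t : Fin N → ℝ) (ht : ∀ i, 0 < t i) (ht1 : ∑ i, t i = 1)
    (p0 : ℝ) (p : Fin N → ℝ) (hp0 : 0 < p0) (hp : ∀ i, 0 < p i)
    (hp1 : p0 + ∑ i, p i = 1)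
    (ξ1 ξ2 : ℝ) (hξ1 : 0 < ξ1) (hξ2 : 0 < ξ2)
    (hξ1e : afun r s t ξ1 = 1) (hξ2e : afun r s p ξ2 = 1)
    (hξeq : ξ1 = ξ2) :
    ∀ k : ℕ, 1 ≤ k →
      (p0 * ((sInf (List.length '' Lam r p0 s t p k) : ℕ) : ℝ)) ^ (ξ1 / (ξ1 + r))
        ≤ ∑ᶠ σ ∈ Lam r p0 s t p k, hfun r p0 s t p σ ^ (ξ1 / (ξ1 + r)) := by
  intro k hk
  have : Nonempty (Fin N) := ⟨⟨0, by omega⟩⟩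
  subst hξeq
  have hs0 : ∀ i, 0 < s i := fun i ↦ (hs i).1
  have ht_le : ∀ i, t i ≤ 1 := fun i ↦
    ht1 ▸ Finset.single_le_sum (fun j _ ↦ (ht j).le) (Finset.mem_univ i)
  have hp_le : ∀ i, p0 + p i ≤ 1 := fun i ↦ by
    have := Finset.single_le_sum (f := p) (fun j _ ↦ (hp j).le) (Finset.mem_univ i)
    linarith
  have hk' : (1 : ℝ) ≤ k := by exact_mod_cast hk
  have hη := etaLow_pos r hs0 ht hp0 hp
  have h0 : etaLow r p0 s t p / k ≤ hfun r p0 s t p [] := by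
    have hnil : hfun r p0 s t p [] = 1 := by simp [hfun, prodw_nil]
    rw [hnil]
    exact (div_le_self hη.le hk').trans (etaLow_le_one hr p0 p hs ht_le)
  obtain ⟨M, hM⟩ : ∃ M : ℕ, ∀ σ : List (Fin N), M ≤ σ.length →
      hfun r p0 s t p σ < etaLow r p0 s t p / k := by
    obtain ⟨i, hi⟩ := Finite.exists_max fun i ↦ s i ^ r
    have hc0 : 0 ≤ s i ^ r := Real.rpow_nonneg (hs0 i).le r
    have hc1 : s i ^ r < 1 := Real.rpow_lt_one (hs0 i).le (hs i).2 hr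
    obtain ⟨M, hM⟩ := exists_pow_lt_of_lt_one (show 0 < etaLow r p0 s t p / k by positivity) hc1
    exact ⟨M, fun σ hσ ↦ ((hfun_le_pow_length r hs0 ht hp0 hp ht_le hp_le hi σ).trans
      (pow_le_pow_of_le_one hc0 hc1.le hσ)).trans_lt hM⟩
  have hfin := finite_Lam hM
  rw [finsum_mem_eq_finite_toFinset_sum _ hfin]
  unfold afun at hξ1e hξ2e
  set e := ξ1 / (ξ1 + r)
  have he0 : 0 < e := by positivity
  have he1 : e ≤ 1 := (div_le_one (by positivity)).2 (by linarith)
  set l := sInf (List.length '' Lam r p0 s t p k)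
  have hx : ∀ j σ, 0 ≤ mixedWeight r s t p j σ := fun j σ ↦
    (mixedWeight_pos r hs0 ht hp j σ).le
  have hlow : ∀ σ ∈ hfin.toFinset,
      p0 ^ e * ((l : ℝ) ^ e * ((l : ℝ)⁻¹ * ∑ j ∈ Finset.range l, mixedWeight r s t p j σ ^ e)) ≤
        hfun r p0 s t p σ ^ e := by
    intro σ hσ
    have hlσ : l ≤ σ.length := Nat.sInf_le ⟨σ, hfin.mem_toFinset.1 hσ, rfl⟩
    have hS : 0 ≤ ∑ j ∈ Finset.range l, mixedWeight r s t p j σ :=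
      Finset.sum_nonneg fun j _ ↦ hx j σ
    calc _ ≤ p0 ^ e * (∑ j ∈ Finset.range l, mixedWeight r s t p j σ) ^ e := by
          gcongr
          exact rpow_mul_sum_rpow_le he0 he1 l fun j ↦ hx j σ
      _ = (p0 * ∑ j ∈ Finset.range l, mixedWeight r s t p j σ) ^ e :=
          (Real.mul_rpow hp0.le hS).symm
      _ ≤ hfun r p0 s t p σ ^ e := by
          gcongr
          rw [hfun_eq]
          refine le_add_of_le_of_nonneg ?_
            (mul_nonneg (prodw_pos hp σ).le (Real.rpow_nonneg (prodw_pos hs0 σ).le r))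
          gcongr
          exact fun j _ _ ↦ hx j σ
  have hmass : (l : ℝ) ≤
      ∑ σ ∈ hfin.toFinset, ∑ j ∈ Finset.range l, mixedWeight r s t p j σ ^ e := by
    rw [Finset.sum_comm]
    have hone : ∀ j ∈ Finset.range l,
        (1 : ℝ) ≤ ∑ σ ∈ hfin.toFinset, mixedWeight r s t p j σ ^ e := fun j _ ↦ by
      simpa [mixedWeight_nil] using weight_nil_le_sum_Lam h0 hM hfin
        (w := fun σ ↦ mixedWeight r s t p j σ ^ e) (fun σ ↦ Real.rpow_nonneg (hx j σ) e)
        (sum_mixedWeight_concat_rpow r e hs0 ht hp hξ1e hξ2e j)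
    simpa using Finset.sum_le_sum hone
  refine le_trans ?_ (Finset.sum_le_sum hlow)
  simp only [← Finset.mul_sum]
  rw [Real.mul_rpow hp0.le l.cast_nonneg]
  gcongr
  rcases Nat.eq_zero_or_pos l with hl | hl
  · simp [hl, he0.ne']
  have hl' : (0 : ℝ) < l := by exact_mod_cast hl
  refine le_mul_of_one_le_right (by positivity) ?_
  calc (1 : ℝ) = (l : ℝ)⁻¹ * l := (inv_mul_cancel₀ hl'.ne').symm
    _ ≤ _ := by gcongr
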